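/- arXiv:2402.11639 — 3 statements merged into one kernel-verified Lean document; each statement's English description precedes it below -/
import Mathlib

section
/- (Signal term, affine tasks, lower bound.) There exists a constant c > 0 depending only on d such that for every L > 0 and n > 5: (i) if w ≥ (d+√d)/2 and 45·√d·w^{d/2} ≤ n/log n, then L_b(w; D(F^aff_L)) ≥ c·L²/w²; and (ii) if 0 ≤ w < (d+√d)/2, then L_b(w; D(F^aff_L)) ≥ c·L². -/
open MeasureTheory Real

noncomputable section

/-- Uniform probability measure on the unit sphere `S^{d-1} ⊆ ℝ^d`, defined as the
normalized `(d-1)`-dimensional Hausdorff measure restricted to the sphere. -/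
def sphereUniform (d : ℕ) : Measure (EuclideanSpace ℝ (Fin d)) :=
  ((μH[(d : ℝ) - 1]) (Metric.sphere (0 : EuclideanSpace ℝ (Fin d)) 1))⁻¹ •
    (μH[(d : ℝ) - 1]).restrict (Metric.sphere (0 : EuclideanSpace ℝ (Fin d)) 1)

/-- Uniform probability measure on the interval `[-L, L]`. -/
def unifIcc (L : ℝ) : Measure ℝ :=
  (ENNReal.ofReal (2 * L))⁻¹ • (volume.restrict (Set.Icc (-L) L))

/-- The softmax attention weight
`γ_i(w) = exp(-w ‖x_i - x_{n+1}‖²) / Σ_j exp(-w ‖x_j - x_{n+1}‖²)`. -/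
def attnW {d n : ℕ} (w : ℝ) (x : Fin (n + 1) → EuclideanSpace ℝ (Fin d)) (i : Fin n) : ℝ :=
  Real.exp (-w * ‖x i.castSucc - x (Fin.last n)‖ ^ 2) /
    ∑ j : Fin n, Real.exp (-w * ‖x j.castSucc - x (Fin.last n)‖ ^ 2)

/-- The signal (bias) term `L_b(w; D)`: the task parameter `θ` is drawn from `τ`
(with task function `F θ`) and the covariates `x_1, …, x_{n+1}` are i.i.d. uniform
on the sphere. -/
def signalTerm (d n : ℕ) {Θ : Type*} [MeasurableSpace Θ] (τ : Measure Θ)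
    (F : Θ → EuclideanSpace ℝ (Fin d) → ℝ) (w : ℝ) : ℝ :=
  ∫ θ, ∫ x : Fin (n + 1) → EuclideanSpace ℝ (Fin d),
      (∑ i : Fin n, attnW w x i * (F θ (x (Fin.last n)) - F θ (x i.castSucc))) ^ 2
    ∂(Measure.pi fun _ : Fin (n + 1) => sphereUniform d) ∂τ

/-- The parameter distribution of the affine task class `D(F^aff_L)`:
`v` uniform on the sphere, `l, b` i.i.d. uniform on `[-L, L]`. -/
def affineTask (d : ℕ) (L : ℝ) : Measure (EuclideanSpace ℝ (Fin d) × ℝ × ℝ) :=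
  (sphereUniform d).prod ((unifIcc L).prod (unifIcc L))

/-- The affine task function `f(x) = l ⬝ vᵀx + b` with parameter `θ = (v, l, b)`. -/
def affineF {d : ℕ} (θ : EuclideanSpace ℝ (Fin d) × ℝ × ℝ)
    (x : EuclideanSpace ℝ (Fin d)) : ℝ :=
  θ.2.1 * (∑ a, θ.1 a * x a) + θ.2.2

/-- The parameter distribution of the ReLU task class `D(F^+_L)`. -/
def reluTask (d : ℕ) (L : ℝ) : Measure (EuclideanSpace ℝ (Fin d) × ℝ × ℝ × ℝ) :=
  (sphereUniform d).prod ((unifIcc L).prod ((unifIcc L).prod (unifIcc L)))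

/-- The ReLU task function `f(x) = l₁ max(vᵀx, 0) + l₂ max(-vᵀx, 0) + b`. -/
def reluF {d : ℕ} (θ : EuclideanSpace ℝ (Fin d) × ℝ × ℝ × ℝ)
    (x : EuclideanSpace ℝ (Fin d)) : ℝ :=
  θ.2.1 * max (∑ a, θ.1 a * x a) 0 + θ.2.2.1 * max (-(∑ a, θ.1 a * x a)) 0 + θ.2.2.2

/-- The sphere near a unit vector `y` is the bi-Lipschitz graph over the orthogonal hyperplane. -/
theorem exists_sphere_chart (m : ℕ) (y : EuclideanSpace ℝ (Fin (m + 1))) (hy : ‖y‖ = 1) :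
    ∃ φ : EuclideanSpace ℝ (Fin m) → EuclideanSpace ℝ (Fin (m + 1)),
      AntilipschitzWith 1 φ ∧
      LipschitzOnWith 2 φ (Metric.closedBall 0 (1 / 2)) ∧
      (∀ u, ‖u‖ ≤ 1 → ‖φ u‖ = 1 ∧ ‖φ u - y‖ ^ 2 = 2 - 2 * √(1 - ‖u‖ ^ 2)) ∧
      ∀ x, ‖x‖ = 1 → 0 ≤ inner ℝ y x → ∃ u, ‖u‖ ≤ ‖x - y‖ ∧ φ u = x := by
  have : Fact (Module.finrank ℝ (EuclideanSpace ℝ (Fin (m + 1))) = m + 1) := ⟨by simp⟩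
  have hy0 : y ≠ 0 := by rintro rfl; simp at hy
  let b := OrthonormalBasis.fromOrthogonalSpanSingleton (𝕜 := ℝ) m hy0
  let ι : EuclideanSpace ℝ (Fin m) →ₗᵢ[ℝ] EuclideanSpace ℝ (Fin (m + 1)) :=
    (Submodule.subtypeₗᵢ _).comp b.repr.symm.toLinearIsometry
  have hι : ∀ u, inner ℝ y (ι u) = 0 := fun u =>
    Submodule.mem_orthogonal_singleton_iff_inner_right.1 (b.repr.symm u).2
  have hpyth : ∀ (a : ℝ) u, ‖a • y + ι u‖ ^ 2 = a ^ 2 + ‖u‖ ^ 2 := by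
    intro a u
    rw [norm_add_sq_real, norm_smul, hy, inner_smul_left, hι, ι.norm_map]
    simp
  let φ : EuclideanSpace ℝ (Fin m) → EuclideanSpace ℝ (Fin (m + 1)) :=
    fun u => √(1 - ‖u‖ ^ 2) • y + ι u
  have hsub : ∀ u v, φ u - φ v = (√(1 - ‖u‖ ^ 2) - √(1 - ‖v‖ ^ 2)) • y + ι (u - v) := by
    intro u v
    simp only [φ, map_sub, sub_smul]
    abel
  refine ⟨φ, ?_, ?_, ?_, ?_⟩
  · refine AntilipschitzWith.of_le_mul_dist fun u v => ?_
    rw [NNReal.coe_one, one_mul, dist_eq_norm, dist_eq_norm, hsub]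
    refine le_of_sq_le_sq ?_ (norm_nonneg _)
    rw [hpyth]
    nlinarith [sq_nonneg (√(1 - ‖u‖ ^ 2) - √(1 - ‖v‖ ^ 2))]
  · refine LipschitzOnWith.of_dist_le_mul fun u hu v hv => ?_
    rw [mem_closedBall_zero_iff] at hu hv
    rw [dist_eq_norm, dist_eq_norm, hsub]
    have hu0 := norm_nonneg u
    have hv0 := norm_nonneg v
    have hsu : (1 : ℝ) / 2 ≤ √(1 - ‖u‖ ^ 2) := Real.le_sqrt_of_sq_le (by nlinarith)
    have hsv : (1 : ℝ) / 2 ≤ √(1 - ‖v‖ ^ 2) := Real.le_sqrt_of_sq_le (by nlinarith)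
    have hqu : √(1 - ‖u‖ ^ 2) ^ 2 = 1 - ‖u‖ ^ 2 := Real.sq_sqrt (by nlinarith)
    have hqv : √(1 - ‖v‖ ^ 2) ^ 2 = 1 - ‖v‖ ^ 2 := Real.sq_sqrt (by nlinarith)
    have hd : |√(1 - ‖u‖ ^ 2) - √(1 - ‖v‖ ^ 2)| ≤ |‖u‖ - ‖v‖| := by
      set a := √(1 - ‖u‖ ^ 2)
      set c := √(1 - ‖v‖ ^ 2)
      have h1 : |a - c| * (a + c) = |‖u‖ - ‖v‖| * (‖u‖ + ‖v‖) := by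
        rw [← abs_of_nonneg (show 0 ≤ a + c by linarith),
          ← abs_of_nonneg (show 0 ≤ ‖u‖ + ‖v‖ by linarith), ← abs_mul, ← abs_mul,
          ← abs_neg]
        congr 1
        nlinarith
      nlinarith [abs_nonneg (a - c), abs_nonneg (‖u‖ - ‖v‖)]
    have hd' := hd.trans (abs_norm_sub_norm_le u v)
    calc _ ≤ ‖(√(1 - ‖u‖ ^ 2) - √(1 - ‖v‖ ^ 2)) • y‖ + ‖ι (u - v)‖ := norm_add_le _ _
      _ ≤ _ := by
        rw [norm_smul, hy, ι.norm_map, Real.norm_eq_abs]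
        push_cast
        linarith
  · intro u hu
    have h1 : √(1 - ‖u‖ ^ 2) ^ 2 = 1 - ‖u‖ ^ 2 :=
      Real.sq_sqrt (by nlinarith [norm_nonneg u])
    constructor
    · have h2 : ‖φ u‖ ^ 2 = 1 := by rw [hpyth, h1]; ring
      exact (pow_eq_one_iff_of_nonneg (norm_nonneg _) two_ne_zero).1 h2
    · have h3 : φ u - y = (√(1 - ‖u‖ ^ 2) - 1) • y + ι u := by
        simp only [φ, sub_smul, one_smul]
        abel
      rw [h3, hpyth]
      nlinarith
  · intro x hx hyx
    have hz : x - inner ℝ y x • y ∈ (Submodule.span ℝ {y})ᗮ := by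
      rw [Submodule.mem_orthogonal_singleton_iff_inner_right, inner_sub_right, inner_smul_right,
        real_inner_self_eq_norm_sq, hy]
      ring
    have hu : ι (b.repr ⟨_, hz⟩) = x - inner ℝ y x • y := by simp [ι]
    have hx' : x = inner ℝ y x • y + ι (b.repr ⟨_, hz⟩) := by rw [hu]; abel
    have hn := hpyth (inner ℝ y x) (b.repr ⟨_, hz⟩)
    rw [← hx', hx] at hn
    have hxy : ‖x - y‖ ^ 2 = 2 - 2 * inner ℝ y x := by
      rw [norm_sub_sq_real, hx, hy, real_inner_comm]
      ring
    refine ⟨b.repr ⟨_, hz⟩, ?_, ?_⟩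
    · refine le_of_sq_le_sq ?_ (norm_nonneg _)
      nlinarith [sq_nonneg (inner ℝ y x - 1)]
    · have : √(1 - ‖b.repr ⟨_, hz⟩‖ ^ 2) = inner ℝ y x := by
        rw [Real.sqrt_eq_iff_mul_self_eq (by nlinarith [sq_nonneg (inner ℝ y x)]) hyx]
        linarith
      simp only [φ]
      rw [this]
      exact hx'.symm

theorem hausdorffMeasure_sphere_inter_closedBall_le (m : ℕ)
    (y : EuclideanSpace ℝ (Fin (m + 1))) (hy : ‖y‖ = 1) {r : ℝ} (hr : 0 ≤ r) (hr' : r ≤ 1 / 2) :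
    μH[(m : ℝ)] (Metric.sphere 0 1 ∩ Metric.closedBall y r) ≤
      ENNReal.ofReal ((2 * r) ^ m) *
        μH[(m : ℝ)] (Metric.ball (0 : EuclideanSpace ℝ (Fin m)) 1) := by
  obtain ⟨φ, -, hlip, -, hsurj⟩ := exists_sphere_chart m y hy
  have : (μH[(m : ℝ)] : Measure (EuclideanSpace ℝ (Fin m))).IsAddHaarMeasure := by
    simpa using isAddHaarMeasure_hausdorffMeasure (E := EuclideanSpace ℝ (Fin m))
  have hsub : Metric.sphere 0 1 ∩ Metric.closedBall y r ⊆ φ '' Metric.closedBall 0 r := by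
    rintro x ⟨hx, hxy⟩
    rw [mem_sphere_zero_iff_norm] at hx
    rw [mem_closedBall_iff_norm] at hxy
    have h1 : ‖x - y‖ ^ 2 = 2 - 2 * inner ℝ y x := by
      rw [norm_sub_sq_real, hx, hy, real_inner_comm]
      ring
    obtain ⟨u, hu, rfl⟩ := hsurj x hx (by nlinarith [norm_nonneg (x - y)])
    exact ⟨u, mem_closedBall_zero_iff.2 (hu.trans hxy), rfl⟩
  calc _ ≤ _ := measure_mono hsub
    _ ≤ ((2 : NNReal) : ENNReal) ^ (m : ℝ) * μH[(m : ℝ)] (Metric.closedBall 0 r) :=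
      (hlip.mono (Metric.closedBall_subset_closedBall hr')).hausdorffMeasure_image_le
        (Nat.cast_nonneg m)
    _ = _ := by
      rw [Measure.addHaar_closedBall _ _ hr, ← mul_assoc, ENNReal.rpow_natCast,
        finrank_euclideanSpace_fin, mul_pow, ENNReal.ofReal_mul (by positivity),
        ENNReal.ofReal_pow zero_le_two]
      simp

theorem le_hausdorffMeasure_sphere_annulus (m : ℕ) (hm : 1 ≤ m)
    (y : EuclideanSpace ℝ (Fin (m + 1))) (hy : ‖y‖ = 1) {r : ℝ} (hr : 0 ≤ r) (hr' : r ≤ 1 / 4) :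
    ENNReal.ofReal ((r / 2) ^ m) * μH[(m : ℝ)] (Metric.ball (0 : EuclideanSpace ℝ (Fin m)) 1) ≤
      μH[(m : ℝ)] (Metric.sphere 0 1 ∩ {x | r ^ 2 ≤ ‖x - y‖ ^ 2 ∧ ‖x - y‖ ^ 2 ≤ 8 * r ^ 2}) := by
  obtain ⟨φ, hanti, -, hnorm, -⟩ := exists_sphere_chart m y hy
  have : (μH[(m : ℝ)] : Measure (EuclideanSpace ℝ (Fin m))).IsAddHaarMeasure := by
    simpa using isAddHaarMeasure_hausdorffMeasure (E := EuclideanSpace ℝ (Fin m))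
  let e : EuclideanSpace ℝ (Fin m) := EuclideanSpace.single ⟨0, hm⟩ (3 * r / 2)
  have he : ‖e‖ = 3 * r / 2 := by
    simp only [e, PiLp.norm_single, Real.norm_eq_abs]
    exact abs_of_nonneg (by positivity)
  have hsub : φ '' Metric.closedBall e (r / 2) ⊆
      Metric.sphere 0 1 ∩ {x | r ^ 2 ≤ ‖x - y‖ ^ 2 ∧ ‖x - y‖ ^ 2 ≤ 8 * r ^ 2} := by
    rintro _ ⟨u, hu, rfl⟩
    rw [mem_closedBall_iff_norm] at hu
    have h1 : ‖u‖ ≤ 2 * r := by linarith [norm_le_norm_add_norm_sub' u e]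
    have h2 : r ≤ ‖u‖ := by linarith [norm_le_norm_add_norm_sub' e u, norm_sub_rev e u]
    obtain ⟨h3, h4⟩ := hnorm u (by linarith)
    have h5 : √(1 - ‖u‖ ^ 2) ≤ 1 - ‖u‖ ^ 2 / 2 :=
      Real.sqrt_le_iff.2 ⟨by nlinarith, by nlinarith [sq_nonneg (‖u‖ ^ 2)]⟩
    have h6 : 1 - ‖u‖ ^ 2 ≤ √(1 - ‖u‖ ^ 2) :=
      Real.le_sqrt_of_sq_le (by nlinarith [sq_nonneg ‖u‖, show ‖u‖ ^ 2 ≤ 1 by nlinarith])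
    refine ⟨mem_sphere_zero_iff_norm.2 h3, ?_, ?_⟩ <;> rw [h4] <;> nlinarith
  calc _ = μH[(m : ℝ)] (Metric.closedBall e (r / 2)) := by
        rw [Measure.addHaar_closedBall _ _ (by positivity), finrank_euclideanSpace_fin]
    _ ≤ _ := by simpa using hanti.le_hausdorffMeasure_image (Nat.cast_nonneg m) _
    _ ≤ _ := measure_mono hsub

theorem hausdorffMeasure_sphere_lt_top (m : ℕ) :
    μH[(m : ℝ)] (Metric.sphere (0 : EuclideanSpace ℝ (Fin (m + 1))) 1) < ⊤ := by
  have : (μH[(m : ℝ)] : Measure (EuclideanSpace ℝ (Fin m))).IsAddHaarMeasure := by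
    simpa using isAddHaarMeasure_hausdorffMeasure (E := EuclideanSpace ℝ (Fin m))
  refine (isCompact_sphere _ _).measure_lt_top_of_nhdsWithin fun y hy => ?_
  refine ⟨Metric.sphere 0 1 ∩ Metric.closedBall y (1 / 2),
    inter_mem_nhdsWithin _ (Metric.closedBall_mem_nhds _ (by norm_num)), ?_⟩
  refine (hausdorffMeasure_sphere_inter_closedBall_le m y (mem_sphere_zero_iff_norm.1 hy)
    (by norm_num) le_rfl).trans_lt ?_
  exact ENNReal.mul_lt_top ENNReal.ofReal_lt_top measure_ball_lt_top

theorem hausdorffMeasure_sphere_pos (m : ℕ) (hm : 1 ≤ m) :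
    0 < μH[(m : ℝ)] (Metric.sphere (0 : EuclideanSpace ℝ (Fin (m + 1))) 1) := by
  have : (μH[(m : ℝ)] : Measure (EuclideanSpace ℝ (Fin m))).IsAddHaarMeasure := by
    simpa using isAddHaarMeasure_hausdorffMeasure (E := EuclideanSpace ℝ (Fin m))
  have h := le_hausdorffMeasure_sphere_annulus m hm (EuclideanSpace.single 0 1) (by simp)
    (r := 1 / 4) (by norm_num) le_rfl
  refine lt_of_lt_of_le ?_ (h.trans (measure_mono Set.inter_subset_left))
  exact ENNReal.mul_pos (by simp) (Metric.measure_ball_pos _ _ one_pos).ne'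

theorem sphereUniform_apply (m : ℕ) (A : Set (EuclideanSpace ℝ (Fin (m + 1)))) :
    sphereUniform (m + 1) A =
      (μH[(m : ℝ)] (Metric.sphere (0 : EuclideanSpace ℝ (Fin (m + 1))) 1))⁻¹ *
        μH[(m : ℝ)] (Metric.sphere 0 1 ∩ A) := by
  simp only [sphereUniform, Nat.cast_add, Nat.cast_one, add_sub_cancel_right, Measure.smul_apply,
    Measure.restrict_apply' Metric.isClosed_sphere.measurableSet, smul_eq_mul]
  rw [Set.inter_comm]

theorem isProbabilityMeasure_sphereUniform (m : ℕ) (hm : 1 ≤ m) :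
    IsProbabilityMeasure (sphereUniform (m + 1)) := by
  refine ⟨?_⟩
  rw [sphereUniform_apply, Set.inter_univ]
  exact ENNReal.inv_mul_cancel (hausdorffMeasure_sphere_pos m hm).ne'
    (hausdorffMeasure_sphere_lt_top m).ne

theorem ae_norm_eq_one_sphereUniform (d : ℕ) : ∀ᵐ x ∂sphereUniform d, ‖x‖ = 1 := by
  refine Measure.ae_smul_measure ?_ _
  filter_upwards [ae_restrict_mem Metric.isClosed_sphere.measurableSet] with x hx
  exact mem_sphere_zero_iff_norm.1 hx

theorem exists_le_sphereUniform_annulus (m : ℕ) (hm : 1 ≤ m) :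
    ∃ c : ℝ, 0 < c ∧ ∀ y : EuclideanSpace ℝ (Fin (m + 1)), ‖y‖ = 1 →
      ∀ r : ℝ, 0 ≤ r → r ≤ 1 / 4 → c * r ^ m ≤
        (sphereUniform (m + 1)).real {x | r ^ 2 ≤ ‖x - y‖ ^ 2 ∧ ‖x - y‖ ^ 2 ≤ 8 * r ^ 2} := by
  have : (μH[(m : ℝ)] : Measure (EuclideanSpace ℝ (Fin m))).IsAddHaarMeasure := by
    simpa using isAddHaarMeasure_hausdorffMeasure (E := EuclideanSpace ℝ (Fin m))
  have := isProbabilityMeasure_sphereUniform m hm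
  set κ := μH[(m : ℝ)] (Metric.ball (0 : EuclideanSpace ℝ (Fin m)) 1)
  set S := μH[(m : ℝ)] (Metric.sphere (0 : EuclideanSpace ℝ (Fin (m + 1))) 1) with hS
  have hκ : 0 < κ.toReal :=
    ENNReal.toReal_pos (Metric.measure_ball_pos _ _ one_pos).ne' measure_ball_lt_top.ne
  have hS' : 0 < S.toReal := ENNReal.toReal_pos (hausdorffMeasure_sphere_pos m hm).ne'
    (hausdorffMeasure_sphere_lt_top m).ne
  refine ⟨S.toReal⁻¹ * κ.toReal * (1 / 2) ^ m, by positivity, fun y hy r hr hr' => ?_⟩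
  rw [measureReal_def, sphereUniform_apply, ENNReal.toReal_mul, ENNReal.toReal_inv]
  have h := ENNReal.toReal_mono
    (measure_mono_top Set.inter_subset_left |>.mt (hausdorffMeasure_sphere_lt_top m).ne)
    (le_hausdorffMeasure_sphere_annulus m hm y hy hr hr')
  rw [ENNReal.toReal_mul, ENNReal.toReal_ofReal (by positivity)] at h
  calc _ = S.toReal⁻¹ * ((r / 2) ^ m * κ.toReal) := by rw [div_pow, div_pow]; ring
    _ ≤ _ := by gcongr

theorem exists_sphereUniform_closedBall_le (m : ℕ) (hm : 1 ≤ m) :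
    ∃ C : ℝ, 0 < C ∧ ∀ y : EuclideanSpace ℝ (Fin (m + 1)), ‖y‖ = 1 →
      ∀ r : ℝ, 0 ≤ r →
        (sphereUniform (m + 1)) (Metric.closedBall y r) ≤ ENNReal.ofReal (C * r ^ m) := by
  have : (μH[(m : ℝ)] : Measure (EuclideanSpace ℝ (Fin m))).IsAddHaarMeasure := by
    simpa using isAddHaarMeasure_hausdorffMeasure (E := EuclideanSpace ℝ (Fin m))
  have := isProbabilityMeasure_sphereUniform m hm
  set κ := μH[(m : ℝ)] (Metric.ball (0 : EuclideanSpace ℝ (Fin m)) 1)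
  set S := μH[(m : ℝ)] (Metric.sphere (0 : EuclideanSpace ℝ (Fin (m + 1))) 1) with hS
  have hκ : κ ≠ ⊤ := measure_ball_lt_top.ne
  have hS' : S⁻¹ ≠ ⊤ := ENNReal.inv_ne_top.2 (hausdorffMeasure_sphere_pos m hm).ne'
  refine ⟨2 ^ m * (S⁻¹.toReal * κ.toReal + 1), by positivity, fun y hy r hr => ?_⟩
  rcases le_total r (1 / 2) with h | h
  · rw [sphereUniform_apply]
    calc _ ≤ S⁻¹ * (ENNReal.ofReal ((2 * r) ^ m) * κ) := by
          gcongr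
          exact hausdorffMeasure_sphere_inter_closedBall_le m y hy hr h
      _ = ENNReal.ofReal (S⁻¹.toReal * ((2 * r) ^ m * κ.toReal)) := by
          rw [ENNReal.ofReal_mul (by positivity), ENNReal.ofReal_mul (by positivity),
            ENNReal.ofReal_toReal hκ, ENNReal.ofReal_toReal hS']
      _ ≤ _ := by
          apply ENNReal.ofReal_le_ofReal
          have : 0 ≤ 2 ^ m * r ^ m := by positivity
          rw [mul_pow]
          linarith
  · refine prob_le_one.trans ?_
    rw [← ENNReal.ofReal_one]
    apply ENNReal.ofReal_le_ofReal
    have h1 : 1 ≤ (2 * r) ^ m := one_le_pow₀ (by linarith)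
    rw [mul_pow] at h1
    have h2 : 0 ≤ 2 ^ m * r ^ m * (S⁻¹.toReal * κ.toReal) := by positivity
    linarith

theorem exists_integral_exp_sphereUniform_le (m : ℕ) (hm : 1 ≤ m) :
    ∃ C : ℝ, 0 < C ∧ ∀ y : EuclideanSpace ℝ (Fin (m + 1)), ‖y‖ = 1 → ∀ w : ℝ, 0 < w →
      ∫ x, Real.exp (-w * ‖x - y‖ ^ 2) ∂sphereUniform (m + 1) ≤ C / √w ^ m := by
  obtain ⟨C, hC, hball⟩ := exists_sphereUniform_closedBall_le m hm
  have := isProbabilityMeasure_sphereUniform m hm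
  let a : ℕ → ℝ := fun k => Real.exp (-(k : ℝ)) * ((k : ℝ) + 1) ^ m
  have ha0 : ∀ k, 0 ≤ a k := fun k => by positivity
  have ha : Summable a := by
    have h := (summable_nat_add_iff 1).2 (Real.summable_pow_mul_exp_neg_nat_mul m one_pos)
    refine (h.mul_left (Real.exp 1)).congr fun k => ?_
    simp only [a]
    push_cast
    rw [mul_comm ((_ : ℝ) ^ m), ← mul_assoc, ← Real.exp_add]
    ring_nf
  refine ⟨C * ∑' k, a k, mul_pos hC (ha.tsum_pos ha0 0 (by simp [a])), fun y hy w hw => ?_⟩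
  have hsw : 0 < √w := Real.sqrt_pos.2 hw
  have hpt : ∀ x : EuclideanSpace ℝ (Fin (m + 1)), ENNReal.ofReal (Real.exp (-w * ‖x - y‖ ^ 2)) ≤
      ∑' k : ℕ, (Metric.closedBall y (√(k + 1) / √w)).indicator
        (fun _ => ENNReal.ofReal (Real.exp (-(k : ℝ)))) x := by
    intro x
    set k := ⌊w * ‖x - y‖ ^ 2⌋₊
    have hk := Nat.floor_le (show 0 ≤ w * ‖x - y‖ ^ 2 by positivity)
    have hk' := Nat.lt_floor_add_one (w * ‖x - y‖ ^ 2)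
    refine le_trans ?_ (ENNReal.le_tsum k)
    rw [Set.indicator_of_mem]
    · apply ENNReal.ofReal_le_ofReal
      apply Real.exp_le_exp.2
      linarith
    · rw [mem_closedBall_iff_norm, le_div_iff₀ hsw]
      apply Real.le_sqrt_of_sq_le
      rw [mul_pow, Real.sq_sqrt hw.le]
      linarith
  rw [integral_eq_lintegral_of_nonneg_ae (Filter.Eventually.of_forall fun x => by positivity)
    (by fun_prop)]
  refine ENNReal.toReal_le_of_le_ofReal
    (div_nonneg (mul_nonneg hC.le (tsum_nonneg ha0)) (by positivity)) ?_
  calc _ ≤ _ := lintegral_mono hpt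
    _ = ∑' k : ℕ, ENNReal.ofReal (Real.exp (-(k : ℝ))) *
        sphereUniform (m + 1) (Metric.closedBall y (√(k + 1) / √w)) := by
      rw [lintegral_tsum fun k =>
        (measurable_const.indicator Metric.isClosed_closedBall.measurableSet).aemeasurable]
      congr 1 with k
      rw [lintegral_indicator_const Metric.isClosed_closedBall.measurableSet]
    _ ≤ ∑' k : ℕ, ENNReal.ofReal (C / √w ^ m * a k) := by
      refine ENNReal.tsum_le_tsum fun k => ?_
      calc _ ≤ ENNReal.ofReal (Real.exp (-(k : ℝ))) *
              ENNReal.ofReal (C * (√(k + 1) / √w) ^ m) := by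
            gcongr
            exact hball y hy _ (by positivity)
        _ = ENNReal.ofReal (Real.exp (-(k : ℝ)) * (C * (√(k + 1) / √w) ^ m)) := by
            rw [← ENNReal.ofReal_mul (by positivity)]
        _ ≤ _ := by
            apply ENNReal.ofReal_le_ofReal
            have h1 : √((k : ℝ) + 1) ≤ k + 1 := by
              have : (0 : ℝ) ≤ k := Nat.cast_nonneg k
              exact Real.sqrt_le_iff.2 ⟨by positivity, by nlinarith⟩
            have h2 : √((k : ℝ) + 1) ^ m ≤ (k + 1) ^ m := by gcongr
            simp only [a]
            rw [div_pow]
            calc _ = C / √w ^ m * (Real.exp (-(k : ℝ)) * √((k : ℝ) + 1) ^ m) := by ring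
              _ ≤ _ := by gcongr
    _ = _ := by
      rw [← ENNReal.ofReal_tsum_of_nonneg (fun k => mul_nonneg (by positivity) (ha0 k))
        (ha.mul_left _), tsum_mul_left]
      congr 1
      ring

theorem exists_le_integral_sq_mul_exp_sphereUniform (m : ℕ) (hm : 1 ≤ m) :
    ∃ c : ℝ, 0 < c ∧ ∀ y : EuclideanSpace ℝ (Fin (m + 1)), ‖y‖ = 1 → ∀ w : ℝ, 0 ≤ w →
      ∀ r : ℝ, 0 ≤ r → r ≤ 1 / 4 →
      c * r ^ (m + 2) * Real.exp (-(8 * w * r ^ 2)) ≤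
        ∫ x, ‖x - y‖ ^ 2 * Real.exp (-w * ‖x - y‖ ^ 2) ∂sphereUniform (m + 1) := by
  obtain ⟨c, hc, hann⟩ := exists_le_sphereUniform_annulus m hm
  have := isProbabilityMeasure_sphereUniform m hm
  refine ⟨c, hc, fun y hy w hw r hr hr' => ?_⟩
  set A := {x | r ^ 2 ≤ ‖x - y‖ ^ 2 ∧ ‖x - y‖ ^ 2 ≤ 8 * r ^ 2}
  have hA : MeasurableSet A := by
    have h : Continuous fun x : EuclideanSpace ℝ (Fin (m + 1)) => ‖x - y‖ ^ 2 := by fun_prop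
    exact ((isClosed_le continuous_const h).inter (isClosed_le h continuous_const)).measurableSet
  have hint : Integrable (fun x => ‖x - y‖ ^ 2 * Real.exp (-w * ‖x - y‖ ^ 2))
      (sphereUniform (m + 1)) := by
    refine Integrable.of_bound (by fun_prop) 4 ?_
    filter_upwards [ae_norm_eq_one_sphereUniform (m + 1)] with x hx
    have h1 : ‖x - y‖ ≤ 2 := by linarith [norm_sub_le x y]
    have h2 : Real.exp (-w * ‖x - y‖ ^ 2) ≤ 1 := by
      apply Real.exp_le_one_iff.2
      nlinarith [sq_nonneg ‖x - y‖]
    rw [Real.norm_of_nonneg (by positivity)]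
    calc _ ≤ (2 : ℝ) ^ 2 * 1 := by gcongr
      _ = 4 := by norm_num
  calc _ = (c * r ^ m) * (r ^ 2 * Real.exp (-(8 * w * r ^ 2))) := by ring
    _ ≤ (sphereUniform (m + 1)).real A * (r ^ 2 * Real.exp (-(8 * w * r ^ 2))) := by
      gcongr
      exact hann y hy r hr hr'
    _ = ∫ x, A.indicator (fun _ => r ^ 2 * Real.exp (-(8 * w * r ^ 2))) x
        ∂sphereUniform (m + 1) := by
      rw [integral_indicator_const _ hA, smul_eq_mul]
    _ ≤ _ := by
      refine integral_mono ((integrable_const _).indicator hA) hint fun x => ?_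
      by_cases hx : x ∈ A
      · simp only [Set.indicator_of_mem hx]
        have h1 : -(8 * w * r ^ 2) ≤ -w * ‖x - y‖ ^ 2 := by nlinarith [hx.2]
        exact mul_le_mul hx.1 (Real.exp_le_exp.2 h1) (by positivity) (by positivity)
      · simp only [Set.indicator_of_notMem hx]
        positivity

/-- Leave-one-out lower bound for the expectation of a softmax-weighted average of i.i.d. terms. -/
theorem le_integral_softmax_average {X : Type*} [MeasurableSpace X] (σ : Measure X)
    [IsProbabilityMeasure σ] (n : ℕ) {g h : X → ℝ} (hg : Measurable g) (g_pos : ∀ x, 0 < g x)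
    (g_le : ∀ x, g x ≤ 1) (hh : Integrable h σ) (h_nonneg : ∀ x, 0 ≤ h x) {M : ℝ}
    (hM : 1 + n * ∫ x, g x ∂σ ≤ M) :
    n * (∫ x, h x * g x ∂σ) / M ≤
      ∫ z : Fin n → X, ∑ i, g (z i) / (∑ j, g (z j)) * h (z i) ∂Measure.pi fun _ => σ := by
  set P : Measure (Fin n → X) := Measure.pi fun _ => σ
  set K := ∫ x, h x * g x ∂σ
  set a := ∫ x, g x ∂σ
  have ha : 0 ≤ a := integral_nonneg fun x => (g_pos x).le
  have hK : 0 ≤ K := integral_nonneg fun x => mul_nonneg (h_nonneg x) (g_pos x).le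
  have hM0 : 0 < M := lt_of_lt_of_le (by positivity) hM
  have hgi : Integrable g σ := Integrable.of_bound hg.aestronglyMeasurable 1
    (Filter.Eventually.of_forall fun x => by
      rw [Real.norm_of_nonneg (g_pos x).le]; exact g_le x)
  have hki : Integrable (fun x => h x * g x) σ :=
    hh.mul_bdd hg.aestronglyMeasurable (Filter.Eventually.of_forall fun x => by
      rw [Real.norm_of_nonneg (g_pos x).le]; exact g_le x)
  have hindep : ∀ i j : Fin n, i ≠ j →
      ProbabilityTheory.IndepFun (fun z : Fin n → X => h (z i) * g (z i)) (fun z => g (z j)) P := by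
    intro i j hij
    have := (ProbabilityTheory.iIndepFun_pi (μ := fun _ : Fin n => σ)
      (X := fun l => if l = i then fun x => h x * g x else g) fun l => by
        split_ifs
        exacts [hki.aemeasurable, hg.aemeasurable]).indepFun hij
    simpa [hij.symm] using this
  have hke : ∀ i : Fin n, Integrable (fun z : Fin n → X => h (z i) * g (z i)) P := fun i =>
    integrable_comp_eval (μ := fun _ => σ) (i := i) (f := fun x => h x * g x) hki
  have hsoft : ∀ i : Fin n,
      Integrable (fun z : Fin n → X => g (z i) / (∑ j, g (z j)) * h (z i)) P := fun i => by
    refine (integrable_comp_eval (μ := fun _ : Fin n => σ) (i := i) hh).bdd_mul (c := 1)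
      (Measurable.aestronglyMeasurable (by fun_prop)) (Filter.Eventually.of_forall fun z => ?_)
    have h1 : g (z i) ≤ ∑ j, g (z j) :=
      Finset.single_le_sum (f := fun j => g (z j)) (fun j _ => (g_pos _).le) (Finset.mem_univ i)
    rw [Real.norm_of_nonneg (div_nonneg (g_pos _).le ((g_pos _).le.trans h1))]
    exact div_le_one_of_le₀ h1 ((g_pos _).le.trans h1)
  have hQi : ∀ i j : Fin n, j ∈ Finset.univ.erase i →
      Integrable (fun z : Fin n → X => h (z i) * g (z i) * g (z j)) P := fun i j _ =>
    (hke i).mul_bdd (hg.comp (measurable_pi_apply j)).aestronglyMeasurable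
      (Filter.Eventually.of_forall fun z => by
        rw [Real.norm_of_nonneg (g_pos _).le]; exact g_le _)
  have hterm : ∀ i : Fin n, K / M ≤ ∫ z, g (z i) / (∑ j, g (z j)) * h (z i) ∂P := by
    intro i
    have hle : ∀ z : Fin n → X,
        h (z i) * g (z i) * (2 / M - 1 / M ^ 2) -
          (∑ j ∈ Finset.univ.erase i, h (z i) * g (z i) * g (z j)) * (1 / M ^ 2) ≤
        g (z i) / (∑ j, g (z j)) * h (z i) := by
      intro z
      have hS := Finset.add_sum_erase Finset.univ (fun j => g (z j)) (Finset.mem_univ i)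
      rw [← Finset.mul_sum]
      set T := ∑ j ∈ Finset.univ.erase i, g (z j)
      have hT : 0 ≤ T := Finset.sum_nonneg fun j _ => (g_pos _).le
      have hS0 : 0 < ∑ j, g (z j) := by
        rw [← hS]
        linarith [g_pos (z i)]
      have hS1 : ∑ j, g (z j) ≤ 1 + T := by
        rw [← hS]
        linarith [g_le (z i)]
      have h1 : 2 / M - (1 + T) / M ^ 2 ≤ 1 / (1 + T) := by
        rw [← sub_nonneg]
        have : 1 / (1 + T) - (2 / M - (1 + T) / M ^ 2) = (M - (1 + T)) ^ 2 / ((1 + T) * M ^ 2) := by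
          field_simp
          ring
        rw [this]
        positivity
      have h2 : 1 / (1 + T) ≤ 1 / ∑ j, g (z j) := one_div_le_one_div_of_le hS0 hS1
      calc _ = h (z i) * g (z i) * (2 / M - (1 + T) / M ^ 2) := by ring
        _ ≤ h (z i) * g (z i) * (1 / ∑ j, g (z j)) :=
          mul_le_mul_of_nonneg_left (h1.trans h2) (mul_nonneg (h_nonneg _) (g_pos _).le)
        _ = _ := by ring
    calc K / M ≤ K * (2 / M - 1 / M ^ 2) -
          (∑ j ∈ Finset.univ.erase i, K * a) * (1 / M ^ 2) := by
          rw [Finset.sum_const, Finset.card_erase_of_mem (Finset.mem_univ i), Finset.card_univ,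
            Fintype.card_fin, nsmul_eq_mul]
          have h1 : ((n - 1 : ℕ) : ℝ) ≤ n := by exact_mod_cast Nat.sub_le n 1
          have h2 : 1 + ((n - 1 : ℕ) : ℝ) * a ≤ M := by nlinarith
          have h3 : K * (1 + ((n - 1 : ℕ) : ℝ) * a) / M ^ 2 ≤ K * M / M ^ 2 := by gcongr
          have h4 : K * M / M ^ 2 = K / M := by field_simp
          calc K / M = 2 * (K / M) - K / M := by ring
            _ ≤ 2 * (K / M) - K * (1 + ((n - 1 : ℕ) : ℝ) * a) / M ^ 2 := by linarith
            _ = _ := by ring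
      _ = ∫ z, (h (z i) * g (z i) * (2 / M - 1 / M ^ 2) -
          (∑ j ∈ Finset.univ.erase i, h (z i) * g (z i) * g (z j)) * (1 / M ^ 2)) ∂P := by
          rw [integral_sub ((hke i).mul_const _)
            ((integrable_finsetSum _ (hQi i)).mul_const _), integral_mul_const,
            integral_mul_const, integral_finsetSum _ (hQi i),
            integral_comp_eval (μ := fun _ => σ) (i := i) (f := fun x => h x * g x) hki.aestronglyMeasurable]
          congr 2
          refine Finset.sum_congr rfl fun j hj => ?_
          rw [(hindep i j (Finset.ne_of_mem_erase hj).symm).integral_fun_mul_eq_mul_integral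
            (hke i).aestronglyMeasurable
            (integrable_comp_eval (i := j) hgi).aestronglyMeasurable,
            integral_comp_eval (μ := fun _ => σ) (i := i) (f := fun x => h x * g x) hki.aestronglyMeasurable,
            integral_comp_eval (μ := fun _ => σ) (i := j) (f := g) hgi.aestronglyMeasurable]
      _ ≤ _ := by
          exact integral_mono (((hke i).mul_const _).sub
            ((integrable_finsetSum _ (hQi i)).mul_const _)) (hsoft i) hle
  rw [integral_finsetSum _ fun i _ => hsoft i]
  calc n * K / M = ∑ _i : Fin n, K / M := by simp [mul_div_assoc]
    _ ≤ _ := Finset.sum_le_sum fun i _ => hterm i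

theorem exists_le_integral_inner_sq_sphereUniform (m : ℕ) (hm : 1 ≤ m) :
    ∃ c : ℝ, 0 < c ∧ ∀ u : EuclideanSpace ℝ (Fin (m + 1)),
      c * ‖u‖ ^ 2 ≤ ∫ v, inner ℝ v u ^ 2 ∂sphereUniform (m + 1) := by
  obtain ⟨c, hc, hann⟩ := exists_le_sphereUniform_annulus m hm
  have := isProbabilityMeasure_sphereUniform m hm
  refine ⟨c * (1 / 8) ^ m / 4, by positivity, fun u => ?_⟩
  rcases eq_or_ne u 0 with rfl | hu
  · simp
  have hu0 : 0 < ‖u‖ := norm_pos_iff.2 hu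
  set y := ‖u‖⁻¹ • u
  have hy : ‖y‖ = 1 := norm_smul_inv_norm (𝕜 := ℝ) hu
  have huy : u = ‖u‖ • y := by simp [y, smul_smul, hu0.ne']
  set A := {x | (1 / 8 : ℝ) ^ 2 ≤ ‖x - y‖ ^ 2 ∧ ‖x - y‖ ^ 2 ≤ 8 * (1 / 8) ^ 2}
  have hA : MeasurableSet A := by
    have h : Continuous fun x : EuclideanSpace ℝ (Fin (m + 1)) => ‖x - y‖ ^ 2 := by fun_prop
    exact ((isClosed_le continuous_const h).inter (isClosed_le h continuous_const)).measurableSet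
  have hint : Integrable (fun v => inner ℝ v u ^ 2) (sphereUniform (m + 1)) := by
    refine Integrable.of_bound (by fun_prop) (‖u‖ ^ 2) ?_
    filter_upwards [ae_norm_eq_one_sphereUniform (m + 1)] with v hv
    rw [Real.norm_of_nonneg (sq_nonneg _)]
    rw [← sq_abs]
    have h := abs_real_inner_le_norm v u
    rw [hv, one_mul] at h
    gcongr
  calc _ = (c * (1 / 8) ^ m) * (‖u‖ ^ 2 / 4) := by ring
    _ ≤ (sphereUniform (m + 1)).real A * (‖u‖ ^ 2 / 4) := by
      gcongr
      exact hann y hy (1 / 8) (by norm_num) (by norm_num)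
    _ = ∫ v, A.indicator (fun _ => ‖u‖ ^ 2 / 4) v ∂sphereUniform (m + 1) := by
      rw [integral_indicator_const _ hA, smul_eq_mul]
    _ ≤ _ := by
      refine integral_mono_ae ((integrable_const _).indicator hA) hint ?_
      filter_upwards [ae_norm_eq_one_sphereUniform (m + 1)] with v hv
      by_cases hx : v ∈ A
      · simp only [Set.indicator_of_mem hx]
        have h1 := norm_sub_sq_real v y
        rw [hv, hy] at h1
        have h2 : 1 / 2 ≤ inner ℝ v y := by linarith [hx.2]
        rw [huy, inner_smul_right, ← huy, mul_pow]
        have h3 : 1 / 4 ≤ inner ℝ v y ^ 2 := by nlinarith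
        nlinarith [mul_le_mul_of_nonneg_left h3 (sq_nonneg ‖u‖)]
      · simp only [Set.indicator_of_notMem hx]
        positivity

theorem isProbabilityMeasure_unifIcc {L : ℝ} (hL : 0 < L) : IsProbabilityMeasure (unifIcc L) := by
  refine ⟨?_⟩
  simp only [unifIcc, Measure.smul_apply, Measure.restrict_apply_univ, Real.volume_Icc, smul_eq_mul]
  rw [show L - -L = 2 * L by ring]
  exact ENNReal.inv_mul_cancel (by simpa using hL) ENNReal.ofReal_ne_top

theorem ae_abs_le_unifIcc (L : ℝ) : ∀ᵐ l ∂unifIcc L, |l| ≤ L := by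
  refine Measure.ae_smul_measure ?_ _
  filter_upwards [ae_restrict_mem measurableSet_Icc] with l hl
  exact abs_le.2 hl

theorem integral_sq_unifIcc {L : ℝ} (hL : 0 < L) : ∫ l, l ^ 2 ∂unifIcc L = L ^ 2 / 3 := by
  rw [unifIcc, integral_smul_measure, integral_Icc_eq_integral_Ioc,
    ← intervalIntegral.integral_of_le (by linarith), integral_pow, ENNReal.toReal_inv,
    ENNReal.toReal_ofReal (by positivity), smul_eq_mul]
  push_cast
  field_simp
  ring

section Covariates

variable {m n : ℕ}

theorem attnW_nonneg {d : ℕ} (w : ℝ) (x : Fin (n + 1) → EuclideanSpace ℝ (Fin d)) (i : Fin n) :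
    0 ≤ attnW w x i :=
  div_nonneg (Real.exp_nonneg _) (Finset.sum_nonneg fun _ _ => Real.exp_nonneg _)

theorem attnW_le_one {d : ℕ} (w : ℝ) (x : Fin (n + 1) → EuclideanSpace ℝ (Fin d)) (i : Fin n) :
    attnW w x i ≤ 1 :=
  div_le_one_of_le₀ (Finset.single_le_sum
    (f := fun j : Fin n => Real.exp (-w * ‖x j.castSucc - x (Fin.last n)‖ ^ 2))
    (fun _ _ => Real.exp_nonneg _) (Finset.mem_univ i))
    (Finset.sum_nonneg fun _ _ => Real.exp_nonneg _)

theorem measurable_attnW {d : ℕ} (w : ℝ) (i : Fin n) :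
    Measurable fun x : Fin (n + 1) → EuclideanSpace ℝ (Fin d) => attnW w x i := by
  unfold attnW
  fun_prop

/-- The displacement of the query covariate from the attention-weighted average. -/
def attnDisp {d : ℕ} (w : ℝ) (x : Fin (n + 1) → EuclideanSpace ℝ (Fin d)) :
    EuclideanSpace ℝ (Fin d) :=
  ∑ i : Fin n, attnW w x i • (x (Fin.last n) - x i.castSucc)

/-- The attention-weighted average of the squared distances to the query covariate. -/
def attnSqDist {d : ℕ} (w : ℝ) (x : Fin (n + 1) → EuclideanSpace ℝ (Fin d)) : ℝ :=
  ∑ i : Fin n, attnW w x i * ‖x i.castSucc - x (Fin.last n)‖ ^ 2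

theorem measurable_attnDisp {d : ℕ} (w : ℝ) :
    Measurable fun x : Fin (n + 1) → EuclideanSpace ℝ (Fin d) => attnDisp w x := by
  have := measurable_attnW (d := d) (n := n) w
  unfold attnDisp
  fun_prop

theorem measurable_attnSqDist {d : ℕ} (w : ℝ) :
    Measurable fun x : Fin (n + 1) → EuclideanSpace ℝ (Fin d) => attnSqDist w x := by
  have := measurable_attnW (d := d) (n := n) w
  unfold attnSqDist
  fun_prop

theorem norm_attnDisp_le {d : ℕ} (w : ℝ) (x : Fin (n + 1) → EuclideanSpace ℝ (Fin d))
    (hx : ∀ i, ‖x i‖ = 1) : ‖attnDisp w x‖ ≤ n * 2 := by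
  refine (norm_sum_le _ _).trans ?_
  calc _ ≤ ∑ _i : Fin n, (2 : ℝ) := Finset.sum_le_sum fun i _ => by
        rw [norm_smul, Real.norm_of_nonneg (attnW_nonneg w x i)]
        have h1 := norm_sub_le (x (Fin.last n)) (x i.castSucc)
        rw [hx, hx] at h1
        nlinarith [attnW_nonneg w x i, attnW_le_one w x i,
          norm_nonneg (x (Fin.last n) - x i.castSucc)]
    _ = n * 2 := by simp

theorem attnSqDist_nonneg {d : ℕ} (w : ℝ) (x : Fin (n + 1) → EuclideanSpace ℝ (Fin d)) :
    0 ≤ attnSqDist w x :=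
  Finset.sum_nonneg fun i _ => mul_nonneg (attnW_nonneg w x i) (sq_nonneg _)

theorem attnSqDist_le_norm_attnDisp {d : ℕ} (w : ℝ) (x : Fin (n + 1) → EuclideanSpace ℝ (Fin d))
    (hx : ∀ i, ‖x i‖ = 1) : attnSqDist w x / 2 ≤ ‖attnDisp w x‖ := by
  have h1 : inner ℝ (x (Fin.last n)) (attnDisp w x) = attnSqDist w x / 2 := by
    rw [attnDisp, inner_sum, attnSqDist, Finset.sum_div]
    refine Finset.sum_congr rfl fun i _ => ?_
    rw [inner_smul_right, inner_sub_right, real_inner_self_eq_norm_sq, norm_sub_sq_real, hx, hx,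
      real_inner_comm]
    ring
  rw [← h1]
  simpa [hx] using real_inner_le_norm (x (Fin.last n)) (attnDisp w x)

theorem ae_forall_norm_eq_one (hm : 1 ≤ m) :
    ∀ᵐ x ∂Measure.pi fun _ : Fin (n + 1) => sphereUniform (m + 1), ∀ i, ‖x i‖ = 1 := by
  have := isProbabilityMeasure_sphereUniform m hm
  have hae := ae_norm_eq_one_sphereUniform (m + 1)
  generalize sphereUniform (m + 1) = σ at *
  exact ae_all_iff.2 fun i =>
    (Measure.quasiMeasurePreserving_eval (fun _ : Fin (n + 1) => σ) i).ae hae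

theorem integrable_norm_attnDisp_sq (hm : 1 ≤ m) (w : ℝ) :
    Integrable (fun x => ‖attnDisp w x‖ ^ 2)
      (Measure.pi fun _ : Fin (n + 1) => sphereUniform (m + 1)) := by
  have := isProbabilityMeasure_sphereUniform m hm
  refine Integrable.of_bound ((measurable_attnDisp w).norm.pow_const 2).aestronglyMeasurable
    ((n * 2) ^ 2) ?_
  filter_upwards [ae_forall_norm_eq_one hm] with x hx
  rw [Real.norm_of_nonneg (sq_nonneg _)]
  have := norm_attnDisp_le w x hx
  gcongr

theorem integrable_attnSqDist (hm : 1 ≤ m) (w : ℝ) :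
    Integrable (fun x => attnSqDist w x)
      (Measure.pi fun _ : Fin (n + 1) => sphereUniform (m + 1)) := by
  have := isProbabilityMeasure_sphereUniform m hm
  refine Integrable.of_bound (measurable_attnSqDist w).aestronglyMeasurable (n * 4) ?_
  filter_upwards [ae_forall_norm_eq_one hm] with x hx
  rw [Real.norm_of_nonneg (attnSqDist_nonneg w x)]
  linarith [attnSqDist_le_norm_attnDisp w x hx, norm_attnDisp_le w x hx]

theorem sq_integral_attnSqDist_le (hm : 1 ≤ m) (w : ℝ) :
    ((∫ x, attnSqDist w x ∂Measure.pi fun _ : Fin (n + 1) => sphereUniform (m + 1)) / 2) ^ 2 ≤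
      ∫ x, ‖attnDisp w x‖ ^ 2 ∂Measure.pi fun _ : Fin (n + 1) => sphereUniform (m + 1) := by
  have := isProbabilityMeasure_sphereUniform m hm
  set P := Measure.pi fun _ : Fin (n + 1) => sphereUniform (m + 1)
  set I := ∫ x, attnSqDist w x ∂P
  calc (I / 2) ^ 2 = ∫ x, (attnSqDist w x * (I / 2) - (I / 2) ^ 2) ∂P := by
        rw [integral_sub ((integrable_attnSqDist hm w).mul_const _) (integrable_const _),
          integral_mul_const, integral_const]
        simp only [probReal_univ, one_smul]
        ring
    _ ≤ _ := by
        refine integral_mono_ae (((integrable_attnSqDist hm w).mul_const _).sub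
          (integrable_const _)) (integrable_norm_attnDisp_sq hm w) ?_
        filter_upwards [ae_forall_norm_eq_one hm] with x hx
        have h1 := attnSqDist_le_norm_attnDisp w x hx
        have h2 := attnSqDist_nonneg w x
        nlinarith [sq_nonneg (attnSqDist w x / 2 - I / 2)]

theorem le_integral_attnSqDist (hm : 1 ≤ m) {w q M : ℝ} (hw : 0 ≤ w) (hM0 : 0 < M)
    (hq : ∀ y : EuclideanSpace ℝ (Fin (m + 1)), ‖y‖ = 1 →
      q ≤ ∫ x, ‖x - y‖ ^ 2 * Real.exp (-w * ‖x - y‖ ^ 2) ∂sphereUniform (m + 1))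
    (hM : ∀ y : EuclideanSpace ℝ (Fin (m + 1)), ‖y‖ = 1 →
      1 + n * ∫ x, Real.exp (-w * ‖x - y‖ ^ 2) ∂sphereUniform (m + 1) ≤ M) :
    n * q / M ≤
      ∫ x, attnSqDist w x ∂Measure.pi fun _ : Fin (n + 1) => sphereUniform (m + 1) := by
  have := isProbabilityMeasure_sphereUniform m hm
  set σ := sphereUniform (m + 1)
  let G : EuclideanSpace ℝ (Fin (m + 1)) × (Fin n → EuclideanSpace ℝ (Fin (m + 1))) → ℝ :=
    fun p => ∑ i, Real.exp (-w * ‖p.2 i - p.1‖ ^ 2) /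
      (∑ j, Real.exp (-w * ‖p.2 j - p.1‖ ^ 2)) * ‖p.2 i - p.1‖ ^ 2
  have mp := measurePreserving_piFinSuccAbove (fun _ : Fin (n + 1) => σ) (Fin.last n)
  have hG : ∀ x : Fin (n + 1) → EuclideanSpace ℝ (Fin (m + 1)), attnSqDist w x =
      G (MeasurableEquiv.piFinSuccAbove (fun _ => EuclideanSpace ℝ (Fin (m + 1))) (Fin.last n) x) := by
    intro x
    simp [G, attnSqDist, attnW, Fin.init]
  have hGi : Integrable G (σ.prod (Measure.pi fun _ => σ)) := by
    rw [← mp.integrable_comp_emb (MeasurableEquiv.measurableEmbedding _)]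
    exact (integrable_attnSqDist hm w).congr (Filter.Eventually.of_forall hG)
  simp_rw [hG]
  rw [mp.integral_comp' G, integral_prod _ hGi]
  calc n * q / M = ∫ _y, n * q / M ∂σ := by simp
    _ ≤ _ := by
      refine integral_mono_ae (integrable_const _) hGi.integral_prod_left ?_
      filter_upwards [ae_norm_eq_one_sphereUniform (m + 1)] with y hy
      refine le_trans ?_ (le_integral_softmax_average σ n
        (g := fun x => Real.exp (-w * ‖x - y‖ ^ 2)) (h := fun x => ‖x - y‖ ^ 2) (by fun_prop)
        (fun _ => Real.exp_pos _) (fun x => Real.exp_le_one_iff.2 ?_) ?_ (fun _ => sq_nonneg _)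
        (hM y hy))
      · have := hq y hy
        gcongr
      · nlinarith [sq_nonneg ‖x - y‖]
      · refine Integrable.of_bound (by fun_prop) 4 ?_
        filter_upwards [ae_norm_eq_one_sphereUniform (m + 1)] with x hx
        rw [Real.norm_of_nonneg (sq_nonneg _)]
        nlinarith [norm_sub_le x y, norm_nonneg (x - y)]

theorem affineF_signal_eq {d : ℕ} (w : ℝ) (θ : EuclideanSpace ℝ (Fin d) × ℝ × ℝ)
    (x : Fin (n + 1) → EuclideanSpace ℝ (Fin d)) :
    ∑ i : Fin n, attnW w x i * (affineF θ (x (Fin.last n)) - affineF θ (x i.castSucc)) =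
      θ.2.1 * inner ℝ θ.1 (attnDisp w x) := by
  have h : ∀ z : EuclideanSpace ℝ (Fin d), ∑ a, θ.1 a * z a = inner ℝ θ.1 z := fun z => by
    simp [PiLp.inner_apply, mul_comm]
  rw [attnDisp, inner_sum, Finset.mul_sum]
  refine Finset.sum_congr rfl fun i _ => ?_
  rw [affineF, affineF, h, h, inner_smul_right, inner_sub_right]
  ring

theorem mul_integral_le_signalTerm (hm : 1 ≤ m) {c : ℝ}
    (hc : ∀ u : EuclideanSpace ℝ (Fin (m + 1)),
      c * ‖u‖ ^ 2 ≤ ∫ v, inner ℝ v u ^ 2 ∂sphereUniform (m + 1))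
    {L : ℝ} (hL : 0 < L) (w : ℝ) :
    c * (L ^ 2 / 3) *
        (∫ x, ‖attnDisp w x‖ ^ 2 ∂Measure.pi fun _ : Fin (n + 1) => sphereUniform (m + 1)) ≤
      signalTerm (m + 1) n (affineTask (m + 1) L) affineF w := by
  have := isProbabilityMeasure_sphereUniform m hm
  have := isProbabilityMeasure_unifIcc hL
  have : IsProbabilityMeasure (affineTask (m + 1) L) := by unfold affineTask; infer_instance
  set P := Measure.pi fun _ : Fin (n + 1) => sphereUniform (m + 1) with hP
  have hmeas : Measurable fun p : (EuclideanSpace ℝ (Fin (m + 1)) × ℝ × ℝ) ×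
      (Fin (n + 1) → EuclideanSpace ℝ (Fin (m + 1))) =>
      (p.1.2.1 * inner ℝ p.1.1 (attnDisp w p.2)) ^ 2 := by
    have h := measurable_attnDisp (d := m + 1) (n := n) w
    fun_prop
  have hint : Integrable (Function.uncurry fun (θ : EuclideanSpace ℝ (Fin (m + 1)) × ℝ × ℝ)
      (x : Fin (n + 1) → EuclideanSpace ℝ (Fin (m + 1))) =>
      (θ.2.1 * inner ℝ θ.1 (attnDisp w x)) ^ 2) ((affineTask (m + 1) L).prod P) := by
    refine Integrable.of_bound hmeas.aestronglyMeasurable ((L * (n * 2)) ^ 2) ?_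
    have h1 : ∀ᵐ p ∂(affineTask (m + 1) L).prod P, ∀ i, ‖p.2 i‖ = 1 :=
      Measure.quasiMeasurePreserving_snd.ae (ae_forall_norm_eq_one hm)
    have h2 : ∀ᵐ p ∂(affineTask (m + 1) L).prod P, ‖p.1.1‖ = 1 :=
      Measure.quasiMeasurePreserving_fst.ae
        (Measure.quasiMeasurePreserving_fst.ae (ae_norm_eq_one_sphereUniform (m + 1)))
    have h3 : ∀ᵐ p ∂(affineTask (m + 1) L).prod P, |p.1.2.1| ≤ L :=
      Measure.quasiMeasurePreserving_fst.ae (Measure.quasiMeasurePreserving_snd.ae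
        (Measure.quasiMeasurePreserving_fst.ae (ae_abs_le_unifIcc L)))
    filter_upwards [h1, h2, h3] with p hp1 hp2 hp3
    rw [Function.uncurry_def, Real.norm_eq_abs, abs_pow, abs_mul]
    have h4 := abs_real_inner_le_norm p.1.1 (attnDisp w p.2)
    rw [hp2, one_mul] at h4
    have h5 := h4.trans (norm_attnDisp_le w p.2 hp1)
    gcongr
  have hinner : ∀ u : EuclideanSpace ℝ (Fin (m + 1)),
      ∫ θ, (θ.2.1 * inner ℝ θ.1 u) ^ 2 ∂affineTask (m + 1) L =
        (∫ v, inner ℝ v u ^ 2 ∂sphereUniform (m + 1)) * (L ^ 2 / 3) := by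
    intro u
    have h1 : ∫ p, p.1 ^ 2 * (1 : ℝ) ∂(unifIcc L).prod (unifIcc L) = L ^ 2 / 3 := by
      rw [integral_prod_mul (fun l : ℝ => l ^ 2) (fun _ : ℝ => (1 : ℝ)), integral_sq_unifIcc hL]
      simp
    rw [← h1, ← integral_prod_mul (fun v => inner ℝ v u ^ 2) (fun p : ℝ × ℝ => p.1 ^ 2 * (1 : ℝ))]
    refine integral_congr_ae (Filter.Eventually.of_forall fun θ => ?_)
    simp only
    ring
  have hint' := hint.integral_prod_right
  simp only [Function.uncurry_apply_pair, hinner] at hint'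
  simp only [signalTerm, affineF_signal_eq]
  rw [integral_integral_swap hint]
  simp only [hinner]
  rw [← integral_const_mul]
  refine integral_mono ((integrable_norm_attnDisp_sq hm w).const_mul _) hint' fun x => ?_
  have h := hc (attnDisp w x)
  calc c * (L ^ 2 / 3) * ‖attnDisp w x‖ ^ 2 = c * ‖attnDisp w x‖ ^ 2 * (L ^ 2 / 3) := by ring
    _ ≤ _ := by gcongr

end Covariates

theorem pow_sqrt_le_of_regime {m n : ℕ} (hn : 5 < n) {w : ℝ}
    (hw : (((m + 1 : ℕ) : ℝ) + √((m + 1 : ℕ) : ℝ)) / 2 ≤ w)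
    (hreg : 45 * √((m + 1 : ℕ) : ℝ) * w ^ (((m + 1 : ℕ) : ℝ) / 2) ≤ (n : ℝ) / Real.log n) :
    1 ≤ w ∧ √w ^ m ≤ n := by
  have hd : 1 ≤ √((m + 1 : ℕ) : ℝ) := Real.one_le_sqrt.2 (by simp)
  have hd' : (1 : ℝ) ≤ ((m + 1 : ℕ) : ℝ) := by simp
  have hw1 : 1 ≤ w := by linarith
  have hn6 : (6 : ℝ) ≤ n := by exact_mod_cast hn
  refine ⟨hw1, ?_⟩
  have hlog : 1 ≤ Real.log n := by
    rw [Real.le_log_iff_exp_le (by linarith)]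
    linarith [Real.exp_one_lt_d9]
  have h1 : (n : ℝ) / Real.log n ≤ n := div_le_self (by linarith) hlog
  have h2 : w ^ (((m + 1 : ℕ) : ℝ) / 2) = √w ^ (m + 1) := by
    rw [Real.sqrt_eq_rpow, ← Real.rpow_natCast, ← Real.rpow_mul (by linarith)]
    congr 1
    ring
  have h3 : √w ^ m ≤ √w ^ (m + 1) :=
    pow_le_pow_right₀ (Real.one_le_sqrt.2 hw1) (Nat.le_succ m)
  rw [h2] at hreg
  have h4 : 0 ≤ √w ^ (m + 1) := by positivity
  nlinarith

/-- Lemma 12 (signal term, affine tasks, lower bound): there is `c > 0` depending only on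
`d` such that (i) in the main regime the signal term is at least `c L²/w²`, and (ii) for
small `w` it is at least `c L²`. -/
theorem affine_signal_lower_bound (d : ℕ) (hd : 2 ≤ d) :
    ∃ c : ℝ, 0 < c ∧
      ∀ n : ℕ, 2 ≤ n → 5 < n →
        ∀ L : ℝ, 0 < L →
          (∀ w : ℝ, ((d : ℝ) + Real.sqrt d) / 2 ≤ w →
            45 * Real.sqrt d * w ^ ((d : ℝ) / 2) ≤ (n : ℝ) / Real.log n →
            c * L ^ 2 / w ^ 2 ≤ signalTerm d n (affineTask d L) affineF w) ∧
          (∀ w : ℝ, 0 ≤ w → w < ((d : ℝ) + Real.sqrt d) / 2 →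
            c * L ^ 2 ≤ signalTerm d n (affineTask d L) affineF w) := by
  obtain ⟨m, rfl⟩ : ∃ m, d = m + 1 := ⟨d - 1, by omega⟩
  have hm : 1 ≤ m := by omega
  have := isProbabilityMeasure_sphereUniform m hm
  obtain ⟨c₁, hc₁, hinner⟩ := exists_le_integral_inner_sq_sphereUniform m hm
  obtain ⟨C, hC, hexp⟩ := exists_integral_exp_sphereUniform_le m hm
  obtain ⟨c₂, hc₂, hsq⟩ := exists_le_integral_sq_mul_exp_sphereUniform m hm
  set W := (((m + 1 : ℕ) : ℝ) + √((m + 1 : ℕ) : ℝ)) / 2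
  have key : ∀ (n : ℕ) (L : ℝ), 0 < L → ∀ w B : ℝ, 0 ≤ B →
      B ≤ ∫ x, attnSqDist w x ∂Measure.pi (fun _ : Fin (n + 1) => sphereUniform (m + 1)) →
      c₁ * (L ^ 2 / 3) * (B / 2) ^ 2 ≤
        signalTerm (m + 1) n (affineTask (m + 1) L) affineF w := by
    intro n L hL w B hB h
    refine le_trans ?_ (mul_integral_le_signalTerm hm hinner hL w)
    refine mul_le_mul_of_nonneg_left (le_trans ?_ (sq_integral_attnSqDist_le hm w))
      (by positivity)
    gcongr
  set q₁ := c₂ * (1 / 4) ^ (m + 2) * Real.exp (-(1 / 2))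
  set q₂ := c₂ * (1 / 4) ^ (m + 2) * Real.exp (-(W / 2))
  have hq₁ : 0 < q₁ := by positivity
  have hq₂ : 0 < q₂ := by positivity
  refine ⟨min (c₁ / 3 * (q₁ / (1 + C) / 2) ^ 2) (c₁ / 3 * (q₂ / 2 / 2) ^ 2), by positivity,
    fun n _ hn L hL => ⟨fun w hw hreg => ?_, fun w hw hwW => ?_⟩⟩
  · obtain ⟨hw1, hnw⟩ := pow_sqrt_le_of_regime hn hw hreg
    have hw0 : 0 < w := by linarith
    have hsw : 1 ≤ √w := Real.one_le_sqrt.2 hw1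
    have hA : 0 < √w ^ m := by positivity
    have hB : q₁ / (1 + C) / w ≤
        ∫ x, attnSqDist w x ∂Measure.pi (fun _ : Fin (n + 1) => sphereUniform (m + 1)) := by
      have h := le_integral_attnSqDist (n := n) (q := q₁ / (√w ^ m * w))
        (M := 1 + n * (C / √w ^ m)) hm hw0.le (by positivity) (fun y hy => ?_) fun y hy => ?_
      · refine le_trans ?_ h
        have h1 : n * (q₁ / (√w ^ m * w)) / (1 + n * (C / √w ^ m)) =
            q₁ * n / ((√w ^ m + n * C) * w) := by
          field_simp
        rw [h1, div_div, div_le_div_iff₀ (by positivity) (by positivity)]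
        have h2 : √w ^ m + n * C ≤ n * (1 + C) := by linarith
        calc q₁ * ((√w ^ m + n * C) * w) ≤ q₁ * ((n * (1 + C)) * w) := by gcongr
          _ = _ := by ring
      · refine le_trans (le_of_eq ?_) (hsq y hy w hw0.le (1 / 4 / √w) (by positivity)
          (div_le_self (by norm_num) hsw))
        have h1 : 8 * w * (1 / 4 / √w) ^ 2 = 1 / 2 := by
          rw [div_pow, Real.sq_sqrt hw0.le]
          field_simp
          norm_num
        rw [h1, div_pow (1 / 4) (√w), pow_add (√w), Real.sq_sqrt hw0.le]
        simp only [q₁]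
        ring
      · have := hexp y hy w hw0
        gcongr
    refine le_trans ?_ (key n L hL w _ (by positivity) hB)
    calc _ ≤ c₁ / 3 * (q₁ / (1 + C) / 2) ^ 2 * L ^ 2 / w ^ 2 := by
          gcongr
          exact min_le_left _ _
      _ = _ := by ring
  · have hn0 : (1 : ℝ) ≤ n := by exact_mod_cast (by omega : 1 ≤ n)
    have hB : q₂ / 2 ≤
        ∫ x, attnSqDist w x ∂Measure.pi (fun _ : Fin (n + 1) => sphereUniform (m + 1)) := by
      have h := le_integral_attnSqDist (n := n) (q := q₂) (M := 1 + n) hm hw (by positivity)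
        (fun y hy => ?_) fun y hy => ?_
      · refine le_trans ?_ h
        rw [div_le_div_iff₀ (by positivity) (by positivity)]
        nlinarith
      · refine le_trans ?_ (hsq y hy w hw (1 / 4) (by norm_num) le_rfl)
        simp only [q₂]
        gcongr
        linarith
      · have h1 : ∫ x, Real.exp (-w * ‖x - y‖ ^ 2) ∂sphereUniform (m + 1) ≤ 1 := by
          have h2 := integral_mono_of_nonneg (μ := sphereUniform (m + 1))
            (Filter.Eventually.of_forall fun x => (Real.exp_pos (-w * ‖x - y‖ ^ 2)).le)
            (integrable_const (1 : ℝ)) (Filter.Eventually.of_forall fun x =>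
              Real.exp_le_one_iff.2 (by nlinarith [sq_nonneg ‖x - y‖]))
          simpa using h2
        nlinarith
    refine le_trans ?_ (key n L hL w _ (by positivity) hB)
    calc _ ≤ c₁ / 3 * (q₂ / 2 / 2) ^ 2 * L ^ 2 := by
          gcongr
          exact min_le_right _ _
      _ = _ := by ring
end
end

section
/- (Noise term is strictly monotone.) For d ≥ 2, n ≥ 2, and σ > 0, and for any w, w' ≥ 0, the noise term satisfies L_noise(w) > L_noise(w') if and only if w > w'. -/
open MeasureTheory Real

noncomputable section

/-- The noise (variance) term
`L_noise(w) = σ² E[ Σ_i e^{-2w‖x_i - x_{n+1}‖²} / (Σ_j e^{-w‖x_j - x_{n+1}‖²})² ]`. -/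
def noiseTerm (d n : ℕ) (σ w : ℝ) : ℝ :=
  σ ^ 2 *
    ∫ x : Fin (n + 1) → EuclideanSpace ℝ (Fin d),
      (∑ i : Fin n, Real.exp (-2 * w * ‖x i.castSucc - x (Fin.last n)‖ ^ 2)) /
        (∑ j : Fin n, Real.exp (-w * ‖x j.castSucc - x (Fin.last n)‖ ^ 2)) ^ 2
      ∂(Measure.pi fun _ : Fin (n + 1) => sphereUniform d)

/-- The `k`-dimensional Hausdorff measure of the unit sphere of a `(k+1)`-dimensional Euclidean
space is finite. -/
theorem hausdorffMeasure_sphere_lt_top_s15 {E : Type*} [NormedAddCommGroup E] [InnerProductSpace ℝ E]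
    [MeasurableSpace E] [BorelSpace E] {k : ℕ} [Fact (Module.finrank ℝ E = k + 1)] :
    μH[(k : ℝ)] (Metric.sphere (0 : E) 1) < ⊤ := by
  have : FiniteDimensional ℝ E := .of_fact_finrank_eq_succ k
  refine (isCompact_sphere (0 : E) 1).measure_lt_top_of_nhdsWithin fun x hx ↦ ?_
  have hx1 : ‖-x‖ = 1 := by simpa using hx
  have hx0 : -x ≠ 0 := by rw [← norm_ne_zero_iff, hx1]; exact one_ne_zero
  let V := (Submodule.span ℝ {-x})ᗮ
  have hV : Module.finrank ℝ V = k := Submodule.finrank_orthogonal_span_singleton hx0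
  let f : V → E := fun w ↦ stereoInvFunAux (-x) (w : E)
  have hf : ContDiff ℝ 1 f := contDiff_stereoInvFunAux.comp V.subtypeL.contDiff
  obtain ⟨K, hK⟩ := hf.contDiffOn.exists_lipschitzOnWith one_ne_zero
    (convex_closedBall (0 : V) 2) (isCompact_closedBall (0 : V) 2)
  refine ⟨f '' Metric.closedBall (0 : V) 2, ?_, ?_⟩
  · have hopen : IsOpen {y : E | innerSL ℝ (-x) y < 0} :=
      isOpen_lt (innerSL ℝ (-x)).continuous continuous_const
    have hmem : x ∈ {y : E | innerSL ℝ (-x) y < 0} := by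
      have : ‖x‖ = 1 := by simpa using hx
      simp [this]
    filter_upwards [mem_nhdsWithin_of_mem_nhds (hopen.mem_nhds hmem), self_mem_nhdsWithin]
      with y hy hys
    have hyx : y ≠ -x := by
      rintro rfl
      replace hy : innerSL ℝ (-x) (-x) < 0 := hy
      simp only [innerSL_apply_apply, real_inner_self_eq_norm_sq, hx1] at hy
      norm_num at hy
    refine ⟨stereoToFun (-x) y, ?_, ?_⟩
    · have hy' : innerSL ℝ (-x) y < 0 := hy
      have hden : 0 < 1 - innerSL ℝ (-x) y := by linarith
      have hproj : ‖V.orthogonalProjectionOnto y‖ ≤ 1 :=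
        (V.norm_orthogonalProjectionOnto_apply_le y).trans_eq (by simpa using hys)
      rw [mem_closedBall_zero_iff, stereoToFun_apply, norm_smul, Real.norm_eq_abs,
        abs_of_pos (by positivity)]
      have : 2 / (1 - innerSL ℝ (-x) y) ≤ 2 := by
        rw [div_le_iff₀ hden]; linarith
      calc _ ≤ 2 * (1 : ℝ) := mul_le_mul this hproj (norm_nonneg _) (by norm_num)
        _ = 2 := by norm_num
    · exact congrArg Subtype.val (stereo_left_inv hx1 (x := ⟨y, hys⟩) hyx)
  · refine (hK.hausdorffMeasure_image_le k.cast_nonneg).trans_lt (ENNReal.mul_lt_top ?_ ?_)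
    · exact ENNReal.rpow_lt_top_of_nonneg k.cast_nonneg ENNReal.coe_ne_top
    · rw [← hV]
      exact (isCompact_closedBall (0 : V) 2).measure_lt_top

/-- Open sets meeting the unit sphere of a `(k+1)`-dimensional Euclidean space meet it in a set of
positive `k`-dimensional Hausdorff measure. -/
theorem hausdorffMeasure_inter_sphere_pos {E : Type*} [NormedAddCommGroup E]
    [InnerProductSpace ℝ E] [MeasurableSpace E] [BorelSpace E] {k : ℕ}
    [Fact (Module.finrank ℝ E = k + 1)] {U : Set E} (hU : IsOpen U) {p : E} (hpU : p ∈ U)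
    (hp : ‖p‖ = 1) : 0 < μH[(k : ℝ)] (U ∩ Metric.sphere (0 : E) 1) := by
  have : FiniteDimensional ℝ E := .of_fact_finrank_eq_succ k
  have hp0 : p ≠ 0 := by rw [← norm_ne_zero_iff, hp]; exact one_ne_zero
  let V := (Submodule.span ℝ {p})ᗮ
  have hV : Module.finrank ℝ V = k := Submodule.finrank_orthogonal_span_singleton hp0
  let g : V → E := fun w ↦ (w : E) + √(1 - ‖w‖ ^ 2) • p
  have hg : Continuous g := by fun_prop
  have hopen : IsOpen (g ⁻¹' U ∩ Metric.ball 0 1) := (hU.preimage hg).inter Metric.isOpen_ball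
  have hsub : g ⁻¹' U ∩ Metric.ball 0 1 ⊆
      V.orthogonalProjectionOnto '' (U ∩ Metric.sphere (0 : E) 1) := by
    rintro w ⟨hwU, hw⟩
    refine ⟨g w, ⟨hwU, ?_⟩, ?_⟩
    · have hw1 : ‖w‖ < 1 := by simpa using hw
      have hnn : 0 ≤ 1 - ‖w‖ ^ 2 := by nlinarith [norm_nonneg w]
      have hinner : inner ℝ (w : E) p = 0 :=
        Submodule.mem_orthogonal_singleton_iff_inner_left.mp w.2
      have hsq : ‖g w‖ ^ 2 = 1 := by
        rw [norm_add_sq_real, inner_smul_right, hinner, norm_smul, hp, Real.norm_eq_abs,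
          abs_of_nonneg (Real.sqrt_nonneg _), mul_one, Real.sq_sqrt hnn]
        simp
      rw [mem_sphere_zero_iff_norm]
      exact (pow_eq_one_iff_of_nonneg (norm_nonneg _) two_ne_zero).mp hsq
    · simp only [g, map_add, map_smul, Submodule.orthogonalProjectionOnto_mem_subspace_eq_self]
      rw [Submodule.orthogonalProjectionOnto_orthogonalComplement_singleton_eq_zero]
      simp
  have hpos : 0 < μH[(k : ℝ)] (g ⁻¹' U ∩ Metric.ball 0 1) := by
    rw [← hV]
    exact hopen.measure_pos _ ⟨0, by simpa [g] using hpU, by simp⟩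
  have hle := (V.lipschitzWith_orthogonalProjectionOnto).hausdorffMeasure_image_le
    k.cast_nonneg (U ∩ Metric.sphere (0 : E) 1)
  rw [ENNReal.coe_one, ENNReal.one_rpow, one_mul] at hle
  exact hpos.trans_le ((measure_mono hsub).trans hle)

theorem hausdorffMeasure_euclideanSpace_sphere_lt_top {d : ℕ} (hd : d ≠ 0) :
    μH[(d : ℝ) - 1] (Metric.sphere (0 : EuclideanSpace ℝ (Fin d)) 1) < ⊤ := by
  obtain ⟨k, rfl⟩ := Nat.exists_eq_succ_of_ne_zero hd
  have : Fact (Module.finrank ℝ (EuclideanSpace ℝ (Fin (k + 1))) = k + 1) := ⟨by simp⟩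
  have h := hausdorffMeasure_sphere_lt_top_s15 (E := EuclideanSpace ℝ (Fin (k + 1))) (k := k)
  simpa using h

theorem hausdorffMeasure_euclideanSpace_inter_sphere_pos {d : ℕ}
    {U : Set (EuclideanSpace ℝ (Fin d))} (hU : IsOpen U) {p : EuclideanSpace ℝ (Fin d)}
    (hpU : p ∈ U) (hp : ‖p‖ = 1) :
    0 < μH[(d : ℝ) - 1] (U ∩ Metric.sphere (0 : EuclideanSpace ℝ (Fin d)) 1) := by
  obtain _ | k := d
  · simp [Subsingleton.elim p 0] at hp
  have : Fact (Module.finrank ℝ (EuclideanSpace ℝ (Fin (k + 1))) = k + 1) := ⟨by simp⟩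
  have h := hausdorffMeasure_inter_sphere_pos (k := k) hU hpU hp
  simpa using h

theorem isProbabilityMeasure_sphereUniform_s15 {d : ℕ} (hd : d ≠ 0) :
    IsProbabilityMeasure (sphereUniform d) := by
  have : NeZero d := ⟨hd⟩
  have hpos := hausdorffMeasure_euclideanSpace_inter_sphere_pos (d := d) isOpen_univ
    (Set.mem_univ (EuclideanSpace.single 0 1)) (by simp)
  rw [Set.univ_inter] at hpos
  refine ⟨?_⟩
  rw [sphereUniform, Measure.smul_apply, Measure.restrict_apply_univ, smul_eq_mul]
  exact ENNReal.inv_mul_cancel hpos.ne' (hausdorffMeasure_euclideanSpace_sphere_lt_top hd).ne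

theorem sphereUniform_pos_of_isOpen {d : ℕ} (hd : d ≠ 0) {U : Set (EuclideanSpace ℝ (Fin d))}
    (hU : IsOpen U) {p : EuclideanSpace ℝ (Fin d)} (hpU : p ∈ U) (hp : ‖p‖ = 1) :
    0 < sphereUniform d U := by
  rw [sphereUniform, Measure.smul_apply, Measure.restrict_apply hU.measurableSet, smul_eq_mul]
  exact ENNReal.mul_pos
    (ENNReal.inv_ne_zero.mpr (hausdorffMeasure_euclideanSpace_sphere_lt_top hd).ne)
    (hausdorffMeasure_euclideanSpace_inter_sphere_pos hU hpU hp).ne'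

/-- The squared `ℓ²` norm of the softmax weights with logits `-w * t i`. -/
def softmaxSqNorm {ι : Type*} [Fintype ι] (t : ι → ℝ) (w : ℝ) : ℝ :=
  (∑ i, Real.exp (-2 * w * t i)) / (∑ j, Real.exp (-w * t j)) ^ 2

theorem softmaxSqNorm_eq {ι : Type*} [Fintype ι] (t : ι → ℝ) (w : ℝ) :
    softmaxSqNorm t w = (∑ i, Real.exp (-w * t i) ^ 2) / (∑ j, Real.exp (-w * t j)) ^ 2 := by
  simp_rw [softmaxSqNorm, ← Real.exp_nat_mul, Nat.cast_ofNat, ← mul_assoc, mul_neg, neg_mul]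

theorem softmaxSqNorm_nonneg {ι : Type*} [Fintype ι] (t : ι → ℝ) (w : ℝ) :
    0 ≤ softmaxSqNorm t w := by
  rw [softmaxSqNorm]
  positivity

theorem softmaxSqNorm_le_one {ι : Type*} [Fintype ι] (t : ι → ℝ) (w : ℝ) :
    softmaxSqNorm t w ≤ 1 := by
  rw [softmaxSqNorm_eq]
  exact div_le_one_of_le₀ (Finset.sum_sq_le_sq_sum_of_nonneg fun i _ ↦ (Real.exp_pos _).le)
    (by positivity)

/-- Chebyshev's sum inequality with weights `a`. -/
theorem sum_sq_mul_sum_mul_le {ι : Type*} [Fintype ι] {a c : ι → ℝ} (ha : ∀ i, 0 ≤ a i)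
    (hac : ∀ i j, 0 ≤ (a i - a j) * (c i - c j)) :
    (∑ i, a i ^ 2) * ∑ i, a i * c i ≤ (∑ i, a i) * ∑ i, a i ^ 2 * c i := by
  have h : 0 ≤ ∑ i, ∑ j, a i * a j * ((a i - a j) * (c i - c j)) :=
    Finset.sum_nonneg fun i _ ↦ Finset.sum_nonneg fun j _ ↦
      mul_nonneg (mul_nonneg (ha i) (ha j)) (hac i j)
  have heq : ∑ i, ∑ j, a i * a j * ((a i - a j) * (c i - c j)) =
      2 * ((∑ i, a i) * (∑ i, a i ^ 2 * c i) - (∑ i, a i ^ 2) * ∑ i, a i * c i) := by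
    have hterm : ∀ i j, a i * a j * ((a i - a j) * (c i - c j)) =
        a i ^ 2 * c i * a j - a i ^ 2 * (a j * c j) - a i * c i * a j ^ 2
          + a i * (a j ^ 2 * c j) := fun i j ↦ by ring
    simp_rw [hterm, Finset.sum_add_distrib, Finset.sum_sub_distrib, ← Finset.sum_mul_sum]
    ring
  linarith

/-- The gap in the weighted Cauchy-Schwarz inequality as a double sum. -/
theorem two_mul_sum_mul_sum_sub_sq {ι : Type*} [Fintype ι] (b c : ι → ℝ) :
    2 * ((∑ i, b i) * (∑ i, b i * c i ^ 2) - (∑ i, b i * c i) ^ 2) =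
      ∑ i, ∑ j, b i * b j * (c i - c j) ^ 2 := by
  have hterm : ∀ i j, b i * b j * (c i - c j) ^ 2 =
      b i * c i ^ 2 * b j - 2 * (b i * c i) * (b j * c j) + b i * (b j * c j ^ 2) :=
    fun i j ↦ by ring
  simp_rw [hterm, Finset.sum_add_distrib, Finset.sum_sub_distrib, ← Finset.sum_mul_sum,
    ← Finset.mul_sum]
  ring

theorem sum_sq_div_sq_sum_le {ι : Type*} [Fintype ι] [Nonempty ι] {a c : ι → ℝ}
    (ha : ∀ i, 0 < a i) (hc : ∀ i, 0 < c i) (hac : ∀ i j, 0 ≤ (a i - a j) * (c i - c j)) :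
    (∑ i, a i ^ 2) / (∑ i, a i) ^ 2 ≤ (∑ i, (a i * c i) ^ 2) / (∑ i, a i * c i) ^ 2 ∧
    ((∃ i j, c i ≠ c j) →
      (∑ i, a i ^ 2) / (∑ i, a i) ^ 2 < (∑ i, (a i * c i) ^ 2) / (∑ i, a i * c i) ^ 2) := by
  have hcheb := sum_sq_mul_sum_mul_le (fun i ↦ (ha i).le) hac
  have hgap := two_mul_sum_mul_sum_sub_sq (fun i ↦ a i ^ 2) c
  have hnn : ∀ i j, 0 ≤ a i ^ 2 * a j ^ 2 * (c i - c j) ^ 2 := fun i j ↦ by positivity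
  have hSS : 0 < ∑ i, a i ^ 2 :=
    Finset.sum_pos (fun i _ ↦ pow_pos (ha i) 2) Finset.univ_nonempty
  have hS : 0 < ∑ i, a i := Finset.sum_pos (fun i _ ↦ ha i) Finset.univ_nonempty
  have hT : 0 < ∑ i, a i * c i :=
    Finset.sum_pos (fun i _ ↦ mul_pos (ha i) (hc i)) Finset.univ_nonempty
  simp_rw [mul_pow]
  set A := ∑ i, a i
  set B := ∑ i, a i ^ 2
  set T := ∑ i, a i * c i
  set P := ∑ i, a i ^ 2 * c i
  set Q := ∑ i, a i ^ 2 * c i ^ 2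
  have hsq : (B * T) ^ 2 ≤ (A * P) ^ 2 := pow_le_pow_left₀ (by positivity) hcheb 2
  rw [div_le_div_iff₀ (by positivity) (by positivity),
    div_lt_div_iff₀ (by positivity) (by positivity)]
  constructor
  · have hCS : P ^ 2 ≤ B * Q := by
      have := Finset.sum_nonneg fun i (_ : i ∈ Finset.univ) ↦
        Finset.sum_nonneg fun j (_ : j ∈ Finset.univ) ↦ hnn i j
      linarith
    refine le_of_mul_le_mul_left ?_ hSS
    nlinarith [mul_le_mul_of_nonneg_left hCS (sq_nonneg A)]
  · rintro ⟨i, j, hij⟩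
    have hCS : P ^ 2 < B * Q := by
      have hpos : 0 < a i ^ 2 * a j ^ 2 * (c i - c j) ^ 2 :=
        mul_pos (mul_pos (pow_pos (ha i) 2) (pow_pos (ha j) 2))
          (sq_pos_of_ne_zero (sub_ne_zero.mpr hij))
      have := Finset.sum_pos' (fun i (_ : i ∈ Finset.univ) ↦
        Finset.sum_nonneg fun j (_ : j ∈ Finset.univ) ↦ hnn i j)
        ⟨i, Finset.mem_univ i, Finset.sum_pos' (fun j _ ↦ hnn i j) ⟨j, Finset.mem_univ j, hpos⟩⟩
      linarith
    refine lt_of_mul_lt_mul_left ?_ hSS.le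
    nlinarith [mul_lt_mul_of_pos_left hCS (pow_pos hS 2)]

theorem softmaxSqNorm_le_and_lt {ι : Type*} [Fintype ι] [Nonempty ι] (t : ι → ℝ) {w w' : ℝ}
    (hw' : 0 ≤ w') (hww : w' < w) :
    softmaxSqNorm t w' ≤ softmaxSqNorm t w ∧
      ((∃ i j, t i ≠ t j) → softmaxSqNorm t w' < softmaxSqNorm t w) := by
  have hd : 0 < w - w' := sub_pos.mpr hww
  have hmul : ∀ i, Real.exp (-w' * t i) * Real.exp (-(w - w') * t i) = Real.exp (-w * t i) :=
    fun i ↦ by rw [← Real.exp_add]; ring_nf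
  have key := sum_sq_div_sq_sum_le (a := fun i ↦ Real.exp (-w' * t i))
    (c := fun i ↦ Real.exp (-(w - w') * t i)) (fun i ↦ Real.exp_pos _) (fun i ↦ Real.exp_pos _) ?_
  · simp_rw [hmul, ← softmaxSqNorm_eq] at key
    refine ⟨key.1, fun ⟨i, j, hij⟩ ↦ key.2 ⟨i, j, fun h ↦ hij ?_⟩⟩
    exact mul_left_cancel₀ (neg_ne_zero.mpr hd.ne') (Real.exp_injective h)
  · intro i j
    rcases le_total (t i) (t j) with h | h
    · exact mul_nonneg (sub_nonneg.mpr (Real.exp_le_exp.mpr (by nlinarith)))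
        (sub_nonneg.mpr (Real.exp_le_exp.mpr (by nlinarith)))
    · exact mul_nonneg_of_nonpos_of_nonpos
        (sub_nonpos.mpr (Real.exp_le_exp.mpr (by nlinarith)))
        (sub_nonpos.mpr (Real.exp_le_exp.mpr (by nlinarith)))

/-- The squared distances from the covariates `x_1, …, x_n` to the query `x_{n+1}`. -/
def sqDistToQuery {d n : ℕ} (x : Fin (n + 1) → EuclideanSpace ℝ (Fin d)) (i : Fin n) : ℝ :=
  ‖x i.castSucc - x (Fin.last n)‖ ^ 2

theorem noiseTerm_eq (d n : ℕ) (σ w : ℝ) :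
    noiseTerm d n σ w = σ ^ 2 * ∫ x, softmaxSqNorm (sqDistToQuery x) w
      ∂(Measure.pi fun _ : Fin (n + 1) => sphereUniform d) :=
  rfl

theorem integrable_softmaxSqNorm_sqDistToQuery {d n : ℕ} [NeZero n] (w : ℝ)
    (μ : Measure (Fin (n + 1) → EuclideanSpace ℝ (Fin d))) [IsFiniteMeasure μ] :
    Integrable (fun x ↦ softmaxSqNorm (sqDistToQuery x) w) μ := by
  have hcont : Continuous fun x : Fin (n + 1) → EuclideanSpace ℝ (Fin d) ↦
      softmaxSqNorm (sqDistToQuery x) w := by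
    simp only [softmaxSqNorm, sqDistToQuery]
    refine Continuous.div (by fun_prop) (by fun_prop) fun x ↦ ?_
    exact pow_ne_zero 2
      (Finset.sum_pos (fun i _ ↦ Real.exp_pos _) Finset.univ_nonempty).ne'
  refine Integrable.of_bound hcont.aestronglyMeasurable 1 (.of_forall fun x ↦ ?_)
  rw [Real.norm_eq_abs, abs_of_nonneg (softmaxSqNorm_nonneg _ _)]
  exact softmaxSqNorm_le_one _ _

theorem measure_pi_sphereUniform_sqDistToQuery_ne_pos {d n : ℕ} (hd : d ≠ 0) {i j : Fin n}
    (hij : i ≠ j) :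
    0 < (Measure.pi fun _ : Fin (n + 1) => sphereUniform d)
      {x | sqDistToQuery x i ≠ sqDistToQuery x j} := by
  have : NeZero d := ⟨hd⟩
  have := isProbabilityMeasure_sphereUniform_s15 hd
  let p : EuclideanSpace ℝ (Fin d) := EuclideanSpace.single 0 1
  have hp : ‖p‖ = 1 := by simp [p]
  let q : Fin (n + 1) → EuclideanSpace ℝ (Fin d) := fun k ↦ if k = i.castSucc then -p else p
  have hq : ∀ k, ‖q k‖ = 1 := fun k ↦ by
    simp only [q]; split_ifs <;> simp [hp]
  have hopen : IsOpen {x : Fin (n + 1) → EuclideanSpace ℝ (Fin d) |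
      sqDistToQuery x i ≠ sqDistToQuery x j} :=
    isOpen_ne_fun (by unfold sqDistToQuery; fun_prop) (by unfold sqDistToQuery; fun_prop)
  have hmem : q ∈ {x : Fin (n + 1) → EuclideanSpace ℝ (Fin d) |
      sqDistToQuery x i ≠ sqDistToQuery x j} := by
    have hlast : Fin.last n ≠ i.castSucc := (Fin.castSucc_lt_last i).ne'
    have hji : j.castSucc ≠ i.castSucc := fun h ↦ hij (Fin.castSucc_injective n h).symm
    have hne : -p - p ≠ 0 := by
      rw [← neg_add', neg_ne_zero, ← two_smul ℝ, ← norm_ne_zero_iff, norm_smul, hp]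
      norm_num
    simp [sqDistToQuery, q, hlast, hji, hne]
  obtain ⟨ε, hε, hball⟩ := Metric.isOpen_iff.mp hopen q hmem
  refine lt_of_lt_of_le ?_ (measure_mono hball)
  rw [ball_pi q hε, Measure.pi_pi]
  exact CanonicallyOrderedAdd.prod_pos.mpr fun k _ ↦
    sphereUniform_pos_of_isOpen hd Metric.isOpen_ball (Metric.mem_ball_self hε) (hq k)

theorem strictMonoOn_noiseTerm {d n : ℕ} (hd : d ≠ 0) (hn : 2 ≤ n) {σ : ℝ} (hσ : σ ≠ 0) :
    StrictMonoOn (noiseTerm d n σ) (Set.Ici 0) := by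
  intro w' hw' w _ hww
  have : NeZero n := ⟨by omega⟩
  have := isProbabilityMeasure_sphereUniform_s15 hd
  rw [noiseTerm_eq, noiseTerm_eq]
  refine mul_lt_mul_of_pos_left ?_ (by positivity)
  have hi := fun v ↦ integrable_softmaxSqNorm_sqDistToQuery v
    (Measure.pi fun _ : Fin (n + 1) => sphereUniform d)
  rw [← sub_pos, ← integral_sub (hi w) (hi w'), integral_pos_iff_support_of_nonneg
    (fun x ↦ sub_nonneg.mpr (softmaxSqNorm_le_and_lt _ hw' hww).1) ((hi w).sub (hi w'))]
  have hij : (⟨0, by omega⟩ : Fin n) ≠ ⟨1, by omega⟩ := by simp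
  refine (measure_pi_sphereUniform_sqDistToQuery_ne_pos hd hij).trans_le
    (measure_mono fun x hx ↦ ?_)
  exact (sub_pos.mpr ((softmaxSqNorm_le_and_lt _ hw' hww).2 ⟨_, _, hx⟩)).ne'

/-- Lemma 16 (noise term is strictly monotone): `L_noise(w) > L_noise(w')` iff `w > w'`. -/
theorem noise_term_strict_mono (d n : ℕ) (hd : 2 ≤ d) (hn : 2 ≤ n)
    (σ : ℝ) (hσ : 0 < σ) (w w' : ℝ) (hw : 0 ≤ w) (hw' : 0 ≤ w') :
    noiseTerm d n σ w' < noiseTerm d n σ w ↔ w' < w := by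
  exact (strictMonoOn_noiseTerm (by omega) hn hσ.ne').lt_iff_lt hw' hw
end
end

section
/- (Similarly sorted rearrangement inequality.) Let n ≥ 2 and let a_1,…,a_n > 0 and b_1,…,b_n > 0 be similarly sorted, i.e. for all indices i, j: a_i > a_j if and only if b_i > b_j. If the b_i are not all equal, then Σ_{i=1}^n a_i² / ( Σ_{i=1}^n a_i )² < Σ_{i=1}^n a_i²·b_i² / ( Σ_{i=1}^n a_i·b_i )². -/
open Finset

/-- The weighted Chebyshev sum identity. -/
theorem sum_sum_weighted_sub_mul_sub {ι R : Type*} [Fintype ι] [CommRing R] (w f g : ι → R) :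
    ∑ i, ∑ j, w i * w j * ((f i - f j) * (g i - g j)) =
      2 * ((∑ i, w i) * (∑ i, w i * (f i * g i)) - (∑ i, w i * f i) * (∑ i, w i * g i)) := by
  have expand : ∀ i j, w i * w j * ((f i - f j) * (g i - g j)) =
      (w i * (f i * g i)) * w j - (w i * f i) * (w j * g j) - (w i * g i) * (w j * f j)
        + w i * (w j * (f j * g j)) := fun i j => by ring
  simp only [expand, sum_add_distrib, sum_sub_distrib, ← Finset.sum_mul_sum]
  ring

/-- Lemma 19 (similarly sorted rearrangement inequality): if `a_i, b_i > 0` are similarly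
sorted and the `b_i` are not all equal, then
`(Σ a_i²)/(Σ a_i)² < (Σ a_i² b_i²)/(Σ a_i b_i)²`. -/
theorem similarly_sorted_rearrangement (n : ℕ) (hn : 2 ≤ n)
    (a b : Fin n → ℝ) (ha : ∀ i, 0 < a i) (hb : ∀ i, 0 < b i)
    (hsort : ∀ i j, a i > a j ↔ b i > b j)
    (hne : ∃ i j, b i ≠ b j) :
    (∑ i, (a i) ^ 2) / (∑ i, a i) ^ 2 <
      (∑ i, (a i) ^ 2 * (b i) ^ 2) / (∑ i, a i * b i) ^ 2 := by
  obtain ⟨k, l, hkl⟩ := hne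
  have hT : 0 < ∑ i, a i := sum_pos (fun i _ => ha i) ⟨k, mem_univ k⟩
  have hS : 0 < ∑ i, a i * b i := sum_pos (fun i _ => mul_pos (ha i) (hb i)) ⟨k, mem_univ k⟩
  have identity := sum_sum_weighted_sub_mul_sub a
    (fun i => (∑ i, a i) * b i - ∑ i, a i * b i)
    (fun i => a i * ((∑ i, a i) * b i + ∑ i, a i * b i))
  have mean_zero : ∑ i, a i * ((∑ i, a i) * b i - ∑ i, a i * b i) = 0 := by
    simp only [mul_sub, sum_sub_distrib, ← sum_mul, mul_left_comm (a _), ← mul_sum]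
    ring
  have second_moment : ∑ i, a i * (((∑ i, a i) * b i - ∑ i, a i * b i) *
      (a i * ((∑ i, a i) * b i + ∑ i, a i * b i))) =
      (∑ i, a i) ^ 2 * (∑ i, a i ^ 2 * b i ^ 2) - (∑ i, a i * b i) ^ 2 * ∑ i, a i ^ 2 := by
    rw [mul_sum, mul_sum, ← sum_sub_distrib]
    exact sum_congr rfl fun i _ => by ring
  rw [mean_zero, second_moment] at identity
  rw [div_lt_div_iff₀ (by positivity) (by positivity)]
  generalize (∑ i, a i) = T at *
  generalize (∑ i, a i * b i) = S at *
  have pos_of_gt : ∀ i j, b j < b i → 0 < a i * a j * ((T * b i - S - (T * b j - S)) *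
      (a i * (T * b i + S) - a j * (T * b j + S))) := fun i j h => by
    have hf : 0 < T * b i - S - (T * b j - S) := by
      linarith [mul_lt_mul_of_pos_left h hT]
    have hg : 0 < a i * (T * b i + S) - a j * (T * b j + S) := by
      have h₁ := mul_pos hT (hb j)
      exact sub_pos.2 (mul_lt_mul ((hsort i j).2 h) (by linarith) (by linarith) (ha i).le)
    exact mul_pos (mul_pos (ha i) (ha j)) (mul_pos hf hg)
  have pos_of_ne : ∀ i j, b i ≠ b j → 0 < a i * a j * ((T * b i - S - (T * b j - S)) *
      (a i * (T * b i + S) - a j * (T * b j + S))) := fun i j h => by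
    rcases h.lt_or_gt with h | h
    · linarith [pos_of_gt j i h]
    · exact pos_of_gt i j h
  have nonneg : ∀ i j, 0 ≤ a i * a j * ((T * b i - S - (T * b j - S)) *
      (a i * (T * b i + S) - a j * (T * b j + S))) := fun i j => by
    by_cases h : b i = b j
    · simp [h]
    · exact (pos_of_ne i j h).le
  have double_sum_pos : 0 < ∑ i, ∑ j, a i * a j * ((T * b i - S - (T * b j - S)) *
      (a i * (T * b i + S) - a j * (T * b j + S))) :=
    sum_pos' (fun i _ => sum_nonneg fun j _ => nonneg i j)
      ⟨k, mem_univ k, sum_pos' (fun j _ => nonneg k j) ⟨l, mem_univ l, pos_of_ne k l hkl⟩⟩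
  rw [identity, zero_mul, sub_zero] at double_sum_pos
  have := pos_of_mul_pos_right (pos_of_mul_pos_right double_sum_pos two_pos.le) hT.le
  linarith
end
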